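/- Fix α < 0. Then Q_p^♯(α,t) = Q_p(α,H_t) is finite for every t ∈ ℝ, the generalized torsional rigidity of the whole space satisfies Q_p(α,ℝ^N) = (p-1)(-1/α)^{1/(p-1)} with Q_p^♯(α,t) ≤ Q_p(α,ℝ^N) for all t ∈ ℝ, and lim_{t → +∞} Q_p^♯(α,t) = (p-1)(-1/α)^{1/(p-1)}. -/

import Mathlib

open MeasureTheory Real Filter Set
open scoped ENNReal Topology RealInnerProductSpace

noncomputable section

/-- Euclidean space `ℝ^N`. -/
abbrev E (N : ℕ) : Type := EuclideanSpace ℝ (Fin N)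

/-- The Gaussian density `φ_N(x) = (2π)^{-N/2} exp(-|x|²/2)`. -/
def phiN (N : ℕ) (x : E N) : ℝ :=
  (2 * π) ^ (-(N : ℝ) / 2) * Real.exp (-‖x‖ ^ 2 / 2)

/-- The Gaussian measure `γ_N`. -/
def gaussM (N : ℕ) : Measure (E N) :=
  volume.withDensity fun x => ENNReal.ofReal (phiN N x)

/-- An element of the weighted Sobolev space `W^{1,p}_0(Ω, φ_N)`: a function together
with its (weak) gradient, arising as a limit of smooth compactly supported functions
with support in `Ω` in the weighted Sobolev norm. -/
structure W1p0 (N : ℕ) (p : ℝ) (Ω : Set (E N)) where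
  toFun : E N → ℝ
  grad : E N → E N
  int_toFun : IntegrableOn toFun Ω (gaussM N)
  memLp_toFun : IntegrableOn (fun x => |toFun x| ^ p) Ω (gaussM N)
  memLp_grad : IntegrableOn (fun x => ‖grad x‖ ^ p) Ω (gaussM N)
  approx : ∃ f : ℕ → E N → ℝ,
      (∀ k, ContDiff ℝ (⊤ : ℕ∞) (f k)) ∧
      (∀ k, HasCompactSupport (f k)) ∧
      (∀ k, tsupport (f k) ⊆ Ω) ∧
      Filter.Tendsto (fun k =>
          (∫ x, |f k x - toFun x| ^ p ∂(gaussM N)) +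
          (∫ x, ‖gradient (f k) x - grad x‖ ^ p ∂(gaussM N)))
        atTop (nhds 0)

/-- First Dirichlet eigenvalue `λ₁(Ω)` of the Gaussian `p`-Laplacian. -/
def lam1 (N : ℕ) (p : ℝ) (Ω : Set (E N)) : ℝ :=
  sInf { r : ℝ | ∃ w : W1p0 N p Ω,
    ¬ (w.toFun =ᵐ[(gaussM N).restrict Ω] (0 : E N → ℝ)) ∧
    r = (∫ x in Ω, ‖w.grad x‖ ^ p ∂(gaussM N)) / (∫ x in Ω, |w.toFun x| ^ p ∂(gaussM N)) }

/-- The functional `F_α`. -/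
def Ffun (N : ℕ) (p : ℝ) (Ω : Set (E N)) (α : ℝ) (w : W1p0 N p Ω) : ℝ :=
  -(∫ x in Ω, ‖w.grad x‖ ^ p ∂(gaussM N)) + α * (∫ x in Ω, |w.toFun x| ^ p ∂(gaussM N))
    + p * (∫ x in Ω, w.toFun x ∂(gaussM N))

/-- The generalized torsional rigidity `Q_p(α,Ω)` (as an extended real number). -/
def Qp (N : ℕ) (p α : ℝ) (Ω : Set (E N)) : EReal :=
  sSup { r : EReal | ∃ w : W1p0 N p Ω, r = ((Ffun N p Ω α w : ℝ) : EReal) }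

/-- Weak solution of the generalized torsion problem
`-div(φ_N |Dv|^{p-2} Dv) = α φ_N |v|^{p-2} v + φ_N` in `Ω`, `v = 0` on `∂Ω`. -/
def IsTorsionSol (N : ℕ) (p : ℝ) (Ω : Set (E N)) (α : ℝ) (v : W1p0 N p Ω) : Prop :=
  ∀ φ : W1p0 N p Ω,
    (∫ x in Ω, ‖v.grad x‖ ^ (p - 2) * ⟪v.grad x, φ.grad x⟫ ∂(gaussM N)) =
      α * (∫ x in Ω, |v.toFun x| ^ (p - 2) * v.toFun x * φ.toFun x ∂(gaussM N))
        + (∫ x in Ω, φ.toFun x ∂(gaussM N))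

/-- Eigenfunction of the Gaussian `p`-Laplacian on `Ω` associated with `lam`. -/
def IsEigenfun (N : ℕ) (p : ℝ) (Ω : Set (E N)) (lam : ℝ) (u : W1p0 N p Ω) : Prop :=
  ¬ (u.toFun =ᵐ[(gaussM N).restrict Ω] (0 : E N → ℝ)) ∧
  ∀ φ : W1p0 N p Ω,
    (∫ x in Ω, ‖u.grad x‖ ^ (p - 2) * ⟪u.grad x, φ.grad x⟫ ∂(gaussM N)) =
      lam * (∫ x in Ω, |u.toFun x| ^ (p - 2) * u.toFun x * φ.toFun x ∂(gaussM N))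

/-- The half-space `H_t = {x : x₁ < t}`. -/
def halfSpace (N : ℕ) (t : ℝ) : Set (E (N + 1)) := { x | x 0 < t }

/-- One-dimensional Gaussian density. -/
def phi1 (σ : ℝ) : ℝ := (2 * π) ^ (-(1 : ℝ) / 2) * Real.exp (-σ ^ 2 / 2)

/-- Gaussian distribution function of `|u|` on `Ω`. -/
def distFun (N : ℕ) (Ω : Set (E N)) (u : E N → ℝ) (t : ℝ) : ℝ :=
  (gaussM N (Ω ∩ { x | t < |u x| })).toReal

/-- Decreasing rearrangement of `u` with respect to the Gaussian measure. -/
def decRearr (N : ℕ) (Ω : Set (E N)) (u : E N → ℝ) (s : ℝ) : ℝ :=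
  sInf { t : ℝ | 0 ≤ t ∧ distFun N Ω u t ≤ s }

/-- One-dimensional Gaussian cumulative distribution function `k`. -/
def gaussCDF (σ : ℝ) : ℝ := ∫ τ in Iio σ, phi1 τ

/-- The Gaussian rearrangement `u^♯` of `u`. -/
def rearr (N : ℕ) (Ω : Set (E (N + 1))) (u : E (N + 1) → ℝ) (x : E (N + 1)) : ℝ :=
  decRearr (N + 1) Ω u (gaussCDF (x 0))

instance isProbabilityMeasure_gaussM (N : ℕ) : IsProbabilityMeasure (gaussM N) := by
  have hpi : (0 : ℝ) < 2 * π := by positivity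
  have hexp : ∫ x : E N, Real.exp (-‖x‖ ^ 2 / 2) = (2 * π) ^ ((N : ℝ) / 2) := by
    have h := GaussianFourier.integral_rexp_neg_mul_sq_norm (V := E N) (b := 1 / 2) (by norm_num)
    rw [finrank_euclideanSpace, Fintype.card_fin] at h
    rw [show 2 * π = π / (1 / 2) by ring, ← h]
    congr with x
    ring_nf
  have hone : ∫ x : E N, phiN N x = 1 := by
    simp only [phiN]
    rw [integral_const_mul, hexp, ← Real.rpow_add hpi, neg_div, neg_add_cancel, Real.rpow_zero]
  have hint : Integrable (phiN N) :=
    not_imp_comm.1 integral_undef (by rw [hone]; exact one_ne_zero)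
  constructor
  rw [gaussM, withDensity_apply _ MeasurableSet.univ, Measure.restrict_univ,
    ← ofReal_integral_eq_lintegral_ofReal hint, hone, ENNReal.ofReal_one]
  exact Eventually.of_forall fun x => by
    show 0 ≤ phiN N x
    unfold phiN
    positivity

/-- The point where `s ↦ α s ^ p + p s` attains its maximum, for `α < 0`. -/
def torsionPeak (p α : ℝ) : ℝ := (-1 / α) ^ (1 / (p - 1))

lemma torsionPeak_pos {p α : ℝ} (hα : α < 0) : 0 < torsionPeak p α :=
  Real.rpow_pos_of_pos (div_pos_of_neg_of_neg (by norm_num) hα) _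

lemma mul_torsionPeak_rpow {p α : ℝ} (hp : 1 < p) (hα : α < 0) :
    α * torsionPeak p α ^ p = -torsionPeak p α := by
  have hpos := torsionPeak_pos (p := p) hα
  have h1 : torsionPeak p α ^ (p - 1) = -1 / α := by
    rw [torsionPeak, ← Real.rpow_mul (div_pos_of_neg_of_neg (by norm_num) hα).le,
      one_div_mul_cancel (by linarith), Real.rpow_one]
  have h2 : torsionPeak p α ^ p = torsionPeak p α ^ (p - 1) * torsionPeak p α := by
    rw [← Real.rpow_add_one hpos.ne', sub_add_cancel]
  rw [h2, h1, ← mul_assoc, mul_div_cancel₀ _ hα.ne, neg_one_mul]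

lemma mul_abs_rpow_add_le {p α : ℝ} (hp : 1 < p) (hα : α < 0) (w : ℝ) :
    α * |w| ^ p + p * w ≤ (p - 1) * torsionPeak p α := by
  have hpos := torsionPeak_pos (p := p) hα
  have hkey := mul_torsionPeak_rpow hp hα
  set s := torsionPeak p α
  have hr : 0 ≤ |w| / s := by positivity
  have hb := one_add_mul_self_le_rpow_one_add (s := |w| / s - 1) (by linarith) hp.le
  rw [add_sub_cancel] at hb
  have hw : |w| ^ p = s ^ p * (|w| / s) ^ p := by
    rw [← Real.mul_rpow hpos.le hr, mul_div_cancel₀ _ hpos.ne']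
  have hs : s * (|w| / s) = |w| := mul_div_cancel₀ _ hpos.ne'
  have hle : p * w ≤ p * |w| := mul_le_mul_of_nonneg_left (le_abs_self w) (by linarith)
  rw [hw, ← mul_assoc, hkey]
  nlinarith [mul_le_mul_of_nonneg_left hb hpos.le]

lemma Ffun_le {N : ℕ} {p α : ℝ} (hp : 1 < p) (hα : α < 0) {Ω : Set (E N)}
    (w : W1p0 N p Ω) : Ffun N p Ω α w ≤ (p - 1) * torsionPeak p α := by
  have hc : 0 ≤ (p - 1) * torsionPeak p α :=
    mul_nonneg (by linarith) (torsionPeak_pos hα).le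
  have hgrad : 0 ≤ ∫ x in Ω, ‖w.grad x‖ ^ p ∂(gaussM N) :=
    integral_nonneg fun x => by positivity
  have hle : ∫ x in Ω, (α * |w.toFun x| ^ p + p * w.toFun x) ∂(gaussM N) ≤
      ∫ x in Ω, (p - 1) * torsionPeak p α ∂(gaussM N) :=
    integral_mono ((w.memLp_toFun.const_mul α).add (w.int_toFun.const_mul p))
      (integrable_const _) fun x => mul_abs_rpow_add_le hp hα _
  rw [integral_add (w.memLp_toFun.const_mul α) (w.int_toFun.const_mul p),
    integral_const_mul, integral_const_mul, setIntegral_const, smul_eq_mul] at hle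
  have hm : (gaussM N).real Ω * ((p - 1) * torsionPeak p α) ≤ (p - 1) * torsionPeak p α :=
    mul_le_of_le_one_left hc measureReal_le_one
  unfold Ffun
  linarith

lemma Qp_le {N : ℕ} {p α : ℝ} (hp : 1 < p) (hα : α < 0) (Ω : Set (E N)) :
    Qp N p α Ω ≤ (((p - 1) * torsionPeak p α : ℝ) : EReal) := by
  refine sSup_le ?_
  rintro r ⟨w, rfl⟩
  exact EReal.coe_le_coe_iff.2 (Ffun_le hp hα w)

lemma norm_gradient {N : ℕ} (f : E N → ℝ) (x : E N) : ‖gradient f x‖ = ‖fderiv ℝ f x‖ := by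
  simp [gradient]

/-- Smooth functions with compact support in `Ω`, as elements of the Sobolev space. -/
def W1p0.ofSmooth {N : ℕ} {p : ℝ} (hp : 0 < p) {Ω : Set (E N)} (f : E N → ℝ)
    (hf : ContDiff ℝ (⊤ : ℕ∞) f) (hc : HasCompactSupport f) (hΩ : tsupport f ⊆ Ω) :
    W1p0 N p Ω where
  toFun := f
  grad := gradient f
  int_toFun := (hf.continuous.integrable_of_hasCompactSupport hc).integrableOn
  memLp_toFun := by
    refine (Continuous.integrable_of_hasCompactSupport ?_ ?_).integrableOn
    · exact hf.continuous.abs.rpow_const fun _ => Or.inr hp.le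
    · exact hc.comp_left (g := fun y => |y| ^ p) (by simp [hp.ne'])
  memLp_grad := by
    simp only [norm_gradient]
    refine (Continuous.integrable_of_hasCompactSupport ?_ ?_).integrableOn
    · exact (hf.continuous_fderiv (by simp)).norm.rpow_const fun _ => Or.inr hp.le
    · exact (hc.fderiv ℝ).comp_left (g := fun y => ‖y‖ ^ p) (by simp [hp.ne'])
  approx := ⟨fun _ => f, fun _ => hf, fun _ => hc, fun _ => hΩ, by simp [hp.ne']⟩

lemma Ffun_ofSmooth {N : ℕ} {p : ℝ} (hp : 0 < p) (α : ℝ) {Ω : Set (E N)} (f : E N → ℝ)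
    (hf : ContDiff ℝ (⊤ : ℕ∞) f) (hc : HasCompactSupport f) (hΩ : tsupport f ⊆ Ω) :
    Ffun N p Ω α (W1p0.ofSmooth hp f hf hc hΩ) =
      -(∫ x, ‖fderiv ℝ f x‖ ^ p ∂(gaussM N)) + α * (∫ x, |f x| ^ p ∂(gaussM N))
        + p * (∫ x, f x ∂(gaussM N)) := by
  have h0 : ∀ x, x ∉ Ω → f x = 0 := fun x hx => image_eq_zero_of_notMem_tsupport (mt (@hΩ x) hx)
  have h1 : ∀ x, x ∉ Ω → fderiv ℝ f x = 0 := fun x hx =>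
    fderiv_of_notMem_tsupport ℝ (mt (@hΩ x) hx)
  simp only [Ffun, W1p0.ofSmooth, norm_gradient]
  rw [setIntegral_eq_integral_of_forall_compl_eq_zero,
    setIntegral_eq_integral_of_forall_compl_eq_zero,
    setIntegral_eq_integral_of_forall_compl_eq_zero h0]
  · intro x hx
    simp [h0 x hx, hp.ne']
  · intro x hx
    simp [h1 x hx, hp.ne']

/-- A smooth bump equal to `1` on the unit ball and supported in the ball of radius `2`. -/
def unitBump (N : ℕ) : ContDiffBump (0 : E N) := ⟨1, 2, one_pos, one_lt_two⟩

/-- The bump of height `s` at scale `R`. -/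
def scaledBump (N : ℕ) (s R : ℝ) (x : E N) : ℝ := s * unitBump N (R⁻¹ • x)

lemma contDiff_scaledBump (N : ℕ) (s R : ℝ) : ContDiff ℝ (⊤ : ℕ∞) (scaledBump N s R) :=
  contDiff_const.mul ((unitBump N).contDiff.comp (contDiff_const_smul _))

lemma support_scaledBump_subset (N : ℕ) (s : ℝ) {R : ℝ} (hR : 0 < R) :
    Function.support (scaledBump N s R) ⊆ Metric.closedBall 0 (2 * R) := by
  intro x hx
  have h1 : R⁻¹ • x ∈ Function.support (unitBump N) := right_ne_zero_of_mul hx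
  rw [(unitBump N).support_eq, mem_ball_zero_iff, norm_smul, norm_inv, Real.norm_of_nonneg hR.le,
    inv_mul_lt_iff₀ hR] at h1
  rw [mem_closedBall_zero_iff, mul_comm]
  exact h1.le

lemma tsupport_scaledBump_subset (N : ℕ) (s : ℝ) {R : ℝ} (hR : 0 < R) :
    tsupport (scaledBump N s R) ⊆ Metric.closedBall 0 (2 * R) :=
  closure_minimal (support_scaledBump_subset N s hR) Metric.isClosed_closedBall

lemma hasCompactSupport_scaledBump (N : ℕ) (s : ℝ) {R : ℝ} (hR : 0 < R) :
    HasCompactSupport (scaledBump N s R) :=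
  HasCompactSupport.of_support_subset_isCompact (isCompact_closedBall _ _)
    (support_scaledBump_subset N s hR)

lemma scaledBump_eq (N : ℕ) (s : ℝ) {R : ℝ} (hR : 0 < R) {x : E N} (hx : ‖x‖ ≤ R) :
    scaledBump N s R x = s := by
  have h1 : unitBump N (R⁻¹ • x) = 1 := by
    refine (unitBump N).one_of_mem_closedBall ?_
    rw [mem_closedBall_zero_iff, norm_smul, norm_inv, Real.norm_of_nonneg hR.le,
      inv_mul_le_iff₀ hR]
    exact hx.trans_eq (mul_one R).symm
  rw [scaledBump, h1, mul_one]

lemma abs_scaledBump_le (N : ℕ) (s R : ℝ) (x : E N) : |scaledBump N s R x| ≤ |s| := by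
  rw [scaledBump, abs_mul, abs_of_nonneg (unitBump N).nonneg]
  exact mul_le_of_le_one_right (abs_nonneg s) (unitBump N).le_one

lemma exists_norm_fderiv_scaledBump_le (N : ℕ) (s : ℝ) :
    ∃ C, ∀ R, 1 ≤ R → ∀ x : E N, ‖fderiv ℝ (scaledBump N s R) x‖ ≤ C := by
  obtain ⟨K, hK⟩ := ((unitBump N).contDiff (n := 1)).lipschitzWith_of_hasCompactSupport
    (unitBump N).hasCompactSupport one_ne_zero
  refine ⟨(‖s‖₊ * K : NNReal), fun R hR x => norm_fderiv_le_of_lipschitz ℝ ?_⟩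
  refine LipschitzWith.of_dist_le_mul fun y z => ?_
  have h1 := hK.dist_le_mul (R⁻¹ • y) (R⁻¹ • z)
  have h2 : dist (R⁻¹ • y) (R⁻¹ • z) ≤ dist y z := by
    rw [dist_smul₀, norm_inv, Real.norm_of_nonneg (by linarith)]
    exact mul_le_of_le_one_left dist_nonneg (inv_le_one_of_one_le₀ hR)
  have h3 : dist (scaledBump N s R y) (scaledBump N s R z) =
      ‖s‖ * dist (unitBump N (R⁻¹ • y)) (unitBump N (R⁻¹ • z)) := by
    rw [Real.dist_eq, Real.dist_eq, scaledBump, scaledBump, ← mul_sub, abs_mul, Real.norm_eq_abs]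
  rw [h3, NNReal.coe_mul, coe_nnnorm, mul_assoc]
  gcongr
  exact h1.trans (by gcongr)

lemma tendsto_integral_scaledBump (N : ℕ) {p : ℝ} (hp : 0 < p) (α s : ℝ) :
    Tendsto (fun R : ℝ => -(∫ x, ‖fderiv ℝ (scaledBump N s R) x‖ ^ p ∂(gaussM N)) +
      α * (∫ x, |scaledBump N s R x| ^ p ∂(gaussM N)) +
        p * (∫ x, scaledBump N s R x ∂(gaussM N))) atTop (𝓝 (α * |s| ^ p + p * s)) := by
  have hcont (R : ℝ) : Continuous (scaledBump N s R) := (contDiff_scaledBump N s R).continuous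
  have hlim (x : E N) : ∀ᶠ R in atTop, scaledBump N s R x = s := by
    filter_upwards [eventually_gt_atTop 0, eventually_ge_atTop ‖x‖] with R h0 hx
    exact scaledBump_eq N s h0 hx
  have hlim' (x : E N) : ∀ᶠ R in atTop, fderiv ℝ (scaledBump N s R) x = 0 := by
    filter_upwards [eventually_gt_atTop 0, eventually_gt_atTop ‖x‖] with R h0 hx
    have hev : scaledBump N s R =ᶠ[𝓝 x] fun _ => s := by
      filter_upwards [Metric.isOpen_ball.mem_nhds (mem_ball_zero_iff.2 hx)] with y hy
      exact scaledBump_eq N s h0 (mem_ball_zero_iff.1 hy).le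
    rw [hev.fderiv_eq, fderiv_const_apply]
  obtain ⟨C, hC⟩ := exists_norm_fderiv_scaledBump_le N s
  have h1 : Tendsto (fun R : ℝ => ∫ x, ‖fderiv ℝ (scaledBump N s R) x‖ ^ p ∂(gaussM N)) atTop
      (𝓝 (∫ _, (0 : ℝ) ∂(gaussM N))) := by
    refine tendsto_integral_filter_of_dominated_convergence (fun _ => C ^ p) ?_ ?_
      (integrable_const _) ?_
    · refine Eventually.of_forall fun R => Continuous.aestronglyMeasurable ?_
      exact ((contDiff_scaledBump N s R).continuous_fderiv (by simp)).norm.rpow_const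
        fun _ => Or.inr hp.le
    · filter_upwards [eventually_ge_atTop 1] with R hR
      refine Eventually.of_forall fun x => ?_
      rw [Real.norm_of_nonneg (by positivity)]
      exact Real.rpow_le_rpow (norm_nonneg _) (hC R hR x) hp.le
    · refine Eventually.of_forall fun x => tendsto_const_nhds.congr' ?_
      filter_upwards [hlim' x] with R hR
      rw [hR, norm_zero, Real.zero_rpow hp.ne']
  have h2 : Tendsto (fun R : ℝ => ∫ x, |scaledBump N s R x| ^ p ∂(gaussM N)) atTop
      (𝓝 (∫ _, |s| ^ p ∂(gaussM N))) := by
    refine tendsto_integral_filter_of_dominated_convergence (fun _ => |s| ^ p) ?_ ?_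
      (integrable_const _) ?_
    · exact Eventually.of_forall fun R =>
        ((hcont R).abs.rpow_const fun _ => Or.inr hp.le).aestronglyMeasurable
    · refine Eventually.of_forall fun R => Eventually.of_forall fun x => ?_
      rw [Real.norm_of_nonneg (by positivity)]
      exact Real.rpow_le_rpow (abs_nonneg _) (abs_scaledBump_le N s R x) hp.le
    · refine Eventually.of_forall fun x => tendsto_const_nhds.congr' ?_
      filter_upwards [hlim x] with R hR
      rw [hR]
  have h3 : Tendsto (fun R : ℝ => ∫ x, scaledBump N s R x ∂(gaussM N)) atTop
      (𝓝 (∫ _, s ∂(gaussM N))) := by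
    refine tendsto_integral_filter_of_dominated_convergence (fun _ => |s|) ?_ ?_
      (integrable_const _) ?_
    · exact Eventually.of_forall fun R => (hcont R).aestronglyMeasurable
    · exact Eventually.of_forall fun R => Eventually.of_forall (abs_scaledBump_le N s R)
    · refine Eventually.of_forall fun x => tendsto_const_nhds.congr' ?_
      filter_upwards [hlim x] with R hR
      rw [hR]
  simpa using (h1.neg.add (h2.const_mul α)).add (h3.const_mul p)

lemma tendsto_Qp {N : ℕ} {p α : ℝ} (hp : 1 < p) (hα : α < 0) {ι : Type*} {l : Filter ι}
    {R : ι → ℝ} (hR : Tendsto R l atTop) {Ω : ι → Set (E N)}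
    (hΩ : ∀ᶠ i in l, Metric.closedBall 0 (2 * R i) ⊆ Ω i) :
    Tendsto (fun i => Qp N p α (Ω i)) l (𝓝 (((p - 1) * torsionPeak p α : ℝ) : EReal)) := by
  have hp0 : 0 < p := one_pos.trans hp
  have hlim := (tendsto_integral_scaledBump N hp0 α (torsionPeak p α)).comp hR
  have hval : α * |torsionPeak p α| ^ p + p * torsionPeak p α = (p - 1) * torsionPeak p α := by
    rw [abs_of_pos (torsionPeak_pos hα), mul_torsionPeak_rpow hp hα]
    ring
  rw [hval] at hlim
  refine tendsto_of_tendsto_of_tendsto_of_le_of_le'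
    ((continuous_coe_real_ereal.tendsto _).comp hlim) tendsto_const_nhds ?_
    (Eventually.of_forall fun i => Qp_le hp hα (Ω i))
  filter_upwards [hΩ, hR.eventually_gt_atTop 0] with i hi h0
  refine le_sSup ⟨W1p0.ofSmooth hp0 _ (contDiff_scaledBump N (torsionPeak p α) (R i))
    (hasCompactSupport_scaledBump N _ h0) ((tsupport_scaledBump_subset N _ h0).trans hi), ?_⟩
  rw [Ffun_ofSmooth]
  rfl

/-- For fixed `α < 0`: `Q_p^♯(α,t) = Q_p(α,H_t)` is finite for every `t`, the generalized
torsional rigidity of the whole space is `Q_p(α,ℝ^N) = (p-1)(-1/α)^{1/(p-1)}`, one has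
`Q_p^♯(α,t) ≤ Q_p(α,ℝ^N)` for all `t`, and `Q_p^♯(α,t) → (p-1)(-1/α)^{1/(p-1)}` as
`t → +∞`. -/
theorem Qp_halfSpace_alpha_neg (N : ℕ) (p : ℝ) (hp : 1 < p) (α : ℝ) (hα : α < 0) :
    (∀ t : ℝ, Qp (N + 1) p α (halfSpace N t) < ⊤) ∧
    Qp (N + 1) p α (Set.univ : Set (E (N + 1))) =
      (((p - 1) * (-1 / α) ^ (1 / (p - 1)) : ℝ) : EReal) ∧
    (∀ t : ℝ, Qp (N + 1) p α (halfSpace N t) ≤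
      Qp (N + 1) p α (Set.univ : Set (E (N + 1)))) ∧
    Filter.Tendsto (fun t : ℝ => Qp (N + 1) p α (halfSpace N t)) atTop
      (nhds (((p - 1) * (-1 / α) ^ (1 / (p - 1)) : ℝ) : EReal)) := by
  have huniv : Qp (N + 1) p α (Set.univ : Set (E (N + 1))) =
      (((p - 1) * torsionPeak p α : ℝ) : EReal) :=
    tendsto_nhds_unique tendsto_const_nhds
      (tendsto_Qp hp hα tendsto_id (Eventually.of_forall fun _ => subset_univ _))
  refine ⟨fun t => (Qp_le hp hα _).trans_lt (EReal.coe_lt_top _), huniv,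
    fun t => huniv ▸ Qp_le hp hα _, ?_⟩
  refine tendsto_Qp hp hα (tendsto_id.atTop_div_const three_pos) ?_
  filter_upwards [eventually_gt_atTop 0] with t ht x hx
  rw [mem_closedBall_zero_iff] at hx
  have h0 : x 0 ≤ ‖x‖ := (le_abs_self _).trans (PiLp.norm_apply_le x 0)
  simp only [id] at hx
  show x 0 < t
  linarith

end
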